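/- arXiv:2105.12534 — 3 statements merged into one kernel-verified Lean document; each statement's English description precedes it below -/
import Mathlib

section
/- An equivalence relation R on ℕ is noncomputably avoiding if and only if R has a least upper bound with every finite equivalence relation: for every equivalence relation S on ℕ with finitely many equivalence classes, some equivalence relation T on ℕ is a least upper bound of R and S. -/
/-- A computable reduction of `R` to `S`: a total computable function `f` with
`R x y ↔ S (f x) (f y)`.  `CompRed R S` means such a reduction exists (`R ≤c S`). -/
def CompRed (R S : ℕ → ℕ → Prop) : Prop :=
  ∃ f : ℕ → ℕ, Computable f ∧ ∀ x y, R x y ↔ S (f x) (f y)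

/-- `R ≡c S`. -/
def EquivC (R S : ℕ → ℕ → Prop) : Prop := CompRed R S ∧ CompRed S R

/-- `R <c S`. -/
def StrictRed (R S : ℕ → ℕ → Prop) : Prop := CompRed R S ∧ ¬ CompRed S R

/-- The identity equivalence relation `Id` on ℕ. -/
def IdEq : ℕ → ℕ → Prop := fun x y => x = y

/-- `Id_n` : congruence modulo `n` on ℕ. -/
def IdN (n : ℕ) : ℕ → ℕ → Prop := fun x y => x % n = y % n

/-- The uniform join `R ⊕ S`. -/
def Join (R S : ℕ → ℕ → Prop) : ℕ → ℕ → Prop := fun a b =>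
  (∃ x y, a = 2 * x ∧ b = 2 * y ∧ R x y) ∨
  (∃ x y, a = 2 * x + 1 ∧ b = 2 * y + 1 ∧ S x y)

/-- The set of equivalence classes of `R`. -/
def classes (R : ℕ → ℕ → Prop) : Set (Set ℕ) := {C | ∃ a, C = {z | R z a}}

/-- `R` is dark: infinitely many classes and `Id` does not reduce to `R`. -/
def Dark (R : ℕ → ℕ → Prop) : Prop := (classes R).Infinite ∧ ¬ CompRed IdEq R

/-- `R` is dark minimal: dark, and everything strictly below has finitely many classes. -/
def DarkMinimal (R : ℕ → ℕ → Prop) : Prop :=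
  Dark R ∧ ∀ S : ℕ → ℕ → Prop, Equivalence S → StrictRed S R → (classes S).Finite

/-- `T` is a least upper bound of `R` and `S` in the computable-reducibility order. -/
def IsLub' (R S T : ℕ → ℕ → Prop) : Prop :=
  CompRed R T ∧ CompRed S T ∧
    ∀ U : ℕ → ℕ → Prop, Equivalence U → CompRed R U → CompRed S U → CompRed T U

/-- `W` is computably enumerable. -/
def CE (W : Set ℕ) : Prop := W = ∅ ∨ ∃ f : ℕ → ℕ, Computable f ∧ W = Set.range f

/-- `R ≤_F S`: `R` restricted to a decidable set `A` computably reduces to `S`,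
and `R` restricted to the complement of `A` has finitely many classes. -/
def FRed (R S : ℕ → ℕ → Prop) : Prop :=
  ∃ A : Set ℕ, ComputablePred (· ∈ A) ∧
    (∃ f : ℕ → ℕ, Computable f ∧ ∀ x ∈ A, ∀ y ∈ A, (R x y ↔ S (f x) (f y))) ∧
    {C : Set ℕ | ∃ a ∉ A, C = {z | z ∉ A ∧ R z a}}.Finite

/-- `U` is a pure quotient of `R ⊕ S`. -/
def PureQuotient (R S U : ℕ → ℕ → Prop) : Prop :=
  (∀ a b, Join R S a b → U a b) ∧
  (∀ x y, U (2 * x) (2 * y) ↔ R x y) ∧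
  (∀ x y, U (2 * x + 1) (2 * y + 1) ↔ S x y)

/-- `R` is noncomputably avoiding: for every finite set of representatives of
noncomputable `R`-classes, some self-reduction of `R` avoids all those classes. -/
def NCA (R : ℕ → ℕ → Prop) : Prop :=
  ∀ F : Finset ℕ, (∀ a ∈ F, ¬ ComputablePred fun z => R z a) →
    ∃ g : ℕ → ℕ, Computable g ∧ (∀ x y, R x y ↔ R (g x) (g y)) ∧
      ∀ a ∈ F, ∀ x, ¬ R (g x) a

/-- `R` is self-full: every computable self-reduction of `R` hits every `R`-class. -/
def SelfFull (R : ℕ → ℕ → Prop) : Prop :=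
  ∀ f : ℕ → ℕ, Computable f → (∀ x y, R x y ↔ R (f x) (f y)) → ∀ y, ∃ x, R (f x) y

/-- `T` is a strong minimal cover of `R`. -/
def StrongMinCover (R T : ℕ → ℕ → Prop) : Prop :=
  StrictRed R T ∧ ∀ X : ℕ → ℕ → Prop, Equivalence X → StrictRed X T → CompRed X R

/-- `f` is a computable reduction of `R` to `S`. -/
def IsRed (R S : ℕ → ℕ → Prop) (f : ℕ → ℕ) : Prop :=
  Computable f ∧ ∀ x y, R x y ↔ S (f x) (f y)

/-- Some computable self-reduction of `R` omits the class of `a`. -/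
def Avoidable (R : ℕ → ℕ → Prop) (a : ℕ) : Prop :=
  ∃ g, IsRed R R g ∧ ∀ x, ¬ R (g x) a

/-! ### Computability -/

theorem ComputablePred.comp' {α β : Type*} [Primcodable α] [Primcodable β] {p : β → Prop}
    (hp : ComputablePred p) {f : α → β} (hf : Computable f) : ComputablePred fun x => p (f x) := by
  obtain ⟨g, hg, rfl⟩ := ComputablePred.computable_iff.1 hp
  exact ComputablePred.computable_iff.2 ⟨_, hg.comp hf, rfl⟩

theorem PrimrecPred.toComputablePred {α : Type*} [Primcodable α] {p : α → Prop}
    (hp : PrimrecPred p) : ComputablePred p := by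
  obtain ⟨h, hp⟩ := hp
  exact ⟨h, hp.to_comp⟩

theorem ComputablePred.and' {α : Type*} [Primcodable α] {p q : α → Prop}
    (hp : ComputablePred p) (hq : ComputablePred q) : ComputablePred fun x => p x ∧ q x := by
  obtain ⟨f, hf, rfl⟩ := ComputablePred.computable_iff.1 hp
  obtain ⟨g, hg, rfl⟩ := ComputablePred.computable_iff.1 hq
  exact ComputablePred.computable_iff.2
    ⟨fun x => f x && g x, Primrec.and.to_comp.comp hf hg, by funext x; simp⟩

theorem ComputablePred.or' {α : Type*} [Primcodable α] {p q : α → Prop}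
    (hp : ComputablePred p) (hq : ComputablePred q) : ComputablePred fun x => p x ∨ q x :=
  (hp.not.and' hq.not).not.of_eq fun x => by tauto

theorem computable_two_mul : Computable fun x : ℕ => 2 * x :=
  (Primrec.nat_mul.comp (Primrec.const 2) Primrec.id).to_comp

theorem computable_two_mul_add_one : Computable fun x : ℕ => 2 * x + 1 :=
  (Primrec.succ.comp (Primrec.nat_mul.comp (Primrec.const 2) Primrec.id)).to_comp

theorem computable_half : Computable fun x : ℕ => x / 2 :=
  (Primrec.nat_div.comp Primrec.id (Primrec.const 2)).to_comp

theorem computablePred_even : ComputablePred fun x : ℕ => x % 2 = 0 :=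
  (Primrec.eq.comp (Primrec.nat_mod.comp Primrec.id (Primrec.const 2))
    (Primrec.const 0)).toComputablePred

theorem ComputablePred.mem_finset (s : Finset ℕ) : ComputablePred fun x => x ∈ s := by
  classical
  induction s using Finset.induction_on with
  | empty => exact (PrimrecPred.toComputablePred
      (Primrec.eq.comp (Primrec.const 0) (Primrec.const 1))).of_eq fun x => by simp
  | insert a s _ ih =>
    exact ((Primrec.eq.comp Primrec.id (Primrec.const a)).toComputablePred.or' ih).of_eq
      fun x => by simp

theorem ComputablePred.of_finite {s : Set ℕ} (hs : s.Finite) : ComputablePred fun x => x ∈ s :=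
  (ComputablePred.mem_finset hs.toFinset).of_eq fun x => by simp

/-- Unbounded search for a witness of a decidable relation is computable. -/
theorem ComputablePred.exists_least {p : ℕ × ℕ → Prop} (hp : ComputablePred p)
    (h : ∀ x, ∃ n, p (x, n)) :
    ∃ f : ℕ → ℕ, Computable f ∧ ∀ x, p (x, f x) ∧ ∀ m, p (x, m) → f x ≤ m := by
  classical
  obtain ⟨g, hg, rfl⟩ := ComputablePred.computable_iff.1 hp
  refine ⟨fun x => Nat.find (h x), ?_, fun x => ⟨Nat.find_spec (h x), fun m hm => Nat.find_min' _ hm⟩⟩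
  have h₁ : Partrec fun x => Nat.rfind fun n => (Part.some (g (x, n)) : Part Bool) :=
    Partrec.rfind (p := fun x n => (Part.some (g (x, n)) : Part Bool)) hg.partrec
  refine Partrec.of_eq h₁ fun x => ?_
  refine Part.eq_some_iff.2 (Nat.mem_rfind.2 ⟨?_, fun {m} hm => ?_⟩)
  · simpa using (Nat.find_spec (h x)).symm
  · simpa using Nat.find_min (h x) hm

theorem Computable.iterate {r : ℕ → ℕ} (hr : Computable r) :
    Computable fun p : ℕ × ℕ => r^[p.1] p.2 := by
  refine (Computable.nat_rec (f := fun p : ℕ × ℕ => p.1) (g := fun p => p.2)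
    (h := fun _ q => r q.2) Computable.fst Computable.snd
    (hr.comp (Computable.snd.comp Computable.snd))).of_eq fun p => ?_
  induction p.1 with
  | zero => rfl
  | succ n ih => rw [Function.iterate_succ_apply', ← ih]

/-- The function acting as `p` on even numbers and as `q` on odd ones. -/
def merge (p q : ℕ → ℕ) (n : ℕ) : ℕ := if n % 2 = 0 then p (n / 2) else q (n / 2)

@[simp] theorem merge_even (p q : ℕ → ℕ) (x : ℕ) : merge p q (2 * x) = p x := by
  simp [merge]

@[simp] theorem merge_odd (p q : ℕ → ℕ) (x : ℕ) : merge p q (2 * x + 1) = q x := by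
  have h₁ : (2 * x + 1) % 2 = 1 := by omega
  have h₂ : (2 * x + 1) / 2 = x := by omega
  simp [merge, h₁, h₂]

theorem Computable.merge {p q : ℕ → ℕ} (hp : Computable p) (hq : Computable q) :
    Computable (merge p q) :=
  ComputablePred.ite (hp.comp computable_half) (hq.comp computable_half) computablePred_even

/-! ### Reductions -/

theorem IsRed.comp {R S T : ℕ → ℕ → Prop} {f g : ℕ → ℕ} (hg : IsRed S T g) (hf : IsRed R S f) :
    IsRed R T (g ∘ f) :=
  ⟨hg.1.comp hf.1, fun x y => (hf.2 x y).trans (hg.2 _ _)⟩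

theorem IsRed.iterate {R : ℕ → ℕ → Prop} {r : ℕ → ℕ} (hr : IsRed R R r) (n : ℕ) :
    IsRed R R r^[n] := by
  induction n with
  | zero => exact ⟨Computable.id, fun _ _ => Iff.rfl⟩
  | succ n ih => rw [Function.iterate_succ']; exact hr.comp ih

section Avoiding

variable {R : ℕ → ℕ → Prop}

/-- A uniformly decidable sequence of distinct classes yields a self-reduction omitting one. -/
theorem exists_omitted_of_uniform (hR : Equivalence R) {A : ℕ → ℕ → Prop}
    (hA : ComputablePred fun p : ℕ × ℕ => A p.1 p.2)
    (hAR : ∀ n x y, A n x → (A n y ↔ R x y))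
    (hinj : ∀ m n x, A m x → A n x → m = n) (hne : ∀ n, ∃ x, A n x) :
    ∃ F, IsRed R R F ∧ ∃ n, ∀ x, ¬ A n (F x) := by
  classical
  obtain ⟨a, ha, ha'⟩ := hA.exists_least hne
  have hlarge : ∀ k, ∃ j, k < a (Nat.pair k j) := by
    intro k
    by_contra! h
    refine not_injective_infinite_finite
      (fun j : ℕ => (⟨a (Nat.pair k j), Nat.lt_succ_of_le (h j)⟩ : Fin (k + 1))) fun i j hij => ?_
    have hij' : a (Nat.pair k i) = a (Nat.pair k j) := congrArg Fin.val hij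
    have h₁ := (ha' (Nat.pair k i)).1
    have h₂ := (ha' (Nat.pair k j)).1
    rw [hij'] at h₁
    simpa using hinj _ _ _ h₁ h₂
  have hpair : Computable fun p : ℕ × ℕ => Nat.pair p.1 p.2 := Primrec₂.natPair.to_comp
  obtain ⟨j, hj, hj'⟩ := ComputablePred.exists_least (p := fun q => q.1 < a (Nat.pair q.1 q.2))
    ((Primrec.nat_lt.toComputablePred).comp' (Computable.fst.pair (ha.comp hpair))) hlarge
  set N : ℕ → ℕ := fun k => Nat.pair k (j k) with hN
  have hNc : Computable N := hpair.comp (Computable.id.pair hj)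
  have hNinj : ∀ k l, N k = N l → k = l := fun k l h => by
    simpa [hN] using congrArg (fun n => n.unpair.1) h
  have hNa : ∀ k, k < a (N k) := fun k => (hj' k).1
  obtain ⟨K, hK, hK'⟩ := ComputablePred.exists_least (p := fun q => A (N q.2) q.1 ∨ q.1 ≤ q.2)
    ((hA.comp' ((hNc.comp Computable.snd).pair Computable.fst)).or' Primrec.nat_le.toComputablePred)
    fun x => ⟨x, Or.inr le_rfl⟩
  have hKe : ∀ k x, A (N k) x → K x = k := by
    intro k x h
    have hk : k < x := (hNa k).trans_le ((ha' _).2 x h)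
    have hle := (hK' x).2 k (Or.inl h)
    rcases (hK' x).1 with h₁ | h₁
    · exact hNinj _ _ (hinj _ _ _ h₁ h)
    · simp only at h₁; omega
  set F : ℕ → ℕ := fun x => if A (N (K x)) x then a (N (K x + 1)) else x with hF
  have hFin : ∀ k x, A (N k) x → F x = a (N (k + 1)) := fun k x h => by
    simp only [hF, hKe k x h, if_pos h]
  have hFout : ∀ x, (∀ k, ¬ A (N k) x) → F x = x := fun x h => by simp [hF, h]
  have hFA : ∀ k x, A (N k) x → A (N (k + 1)) (F x) := fun k x h => by
    rw [hFin k x h]; exact (ha' _).1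
  refine ⟨F, ⟨?_, ?_⟩, N 0, ?_⟩
  · exact ComputablePred.ite (ha.comp (hNc.comp (Computable.succ.comp hK))) Computable.id
      (hA.comp' ((hNc.comp hK).pair Computable.id))
  · intro x y
    by_cases hx : ∃ k, A (N k) x
    · obtain ⟨k, hx⟩ := hx
      by_cases hy : ∃ l, A (N l) y
      · obtain ⟨l, hy⟩ := hy
        rw [← hAR _ _ _ hx, ← hAR _ _ _ (hFA _ _ hx)]
        constructor
        · intro h
          have := hNinj _ _ (hinj _ _ _ h hy)
          subst this
          exact hFA _ _ hy
        · intro h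
          have := hNinj _ _ (hinj _ _ _ h (hFA _ _ hy))
          obtain rfl : k = l := by omega
          exact hy
      · rw [hFout y (not_exists.1 hy), ← hAR _ _ _ hx, ← hAR _ _ _ (hFA _ _ hx)]
        exact iff_of_false (fun h => hy ⟨_, h⟩) (fun h => hy ⟨_, h⟩)
    · rw [hFout x (not_exists.1 hx)]
      by_cases hy : ∃ l, A (N l) y
      · obtain ⟨l, hy⟩ := hy
        refine iff_of_false (fun h => hx ⟨l, ?_⟩) (fun h => hx ⟨l + 1, ?_⟩)
        · exact (hAR _ _ _ hy).2 (hR.symm h)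
        · exact (hAR _ _ _ (hFA _ _ hy)).2 (hR.symm h)
      · rw [hFout y (not_exists.1 hy)]
  · intro x h
    by_cases hx : ∃ k, A (N k) x
    · obtain ⟨k, hx⟩ := hx
      have := hNinj _ _ (hinj _ _ _ h (hFA _ _ hx))
      omega
    · rw [hFout x (not_exists.1 hx)] at h
      exact hx ⟨0, h⟩

/-- A self-reduction under which a noncomputable class has computable preimage can be
turned into one omitting that class. -/
theorem avoidable_of_computable_preimage (hR : Equivalence R) {b : ℕ}
    (hb : ¬ ComputablePred fun z => R z b) {r : ℕ → ℕ} (hr : IsRed R R r)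
    (hrb : ComputablePred fun x => R (r x) b) : Avoidable R b := by
  by_cases hne : ∀ n, ∃ x, R (r^[n + 1] x) b
  · have hA : ComputablePred fun p : ℕ × ℕ => R (r^[p.1 + 1] p.2) b :=
      (hrb.comp' hr.1.iterate).of_eq fun p => by rw [Function.iterate_succ_apply']
    have hnot : ∀ m n x, R (r^[m + 1] x) b → R (r^[n + 1] x) b → ¬ m < n := by
      intro m n x hm hn hlt
      obtain ⟨d, rfl⟩ := Nat.exists_eq_add_of_lt hlt
      refine hb ((hA.comp' ((Computable.const d).pair Computable.id)).of_eq fun z => ?_)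
      have h₁ : R (r^[d + 1] b) b := by
        refine hR.trans (hR.symm (((hr.iterate (d + 1)).2 _ _).1 hm)) ?_
        rw [← Function.iterate_add_apply]
        rwa [show d + 1 + (m + 1) = m + d + 1 + 1 by omega]
      rw [(hr.iterate (d + 1)).2 z b]
      exact ⟨fun h => hR.trans h (hR.symm h₁), fun h => hR.trans h h₁⟩
    obtain ⟨F, hF, n, hn⟩ := exists_omitted_of_uniform hR (A := fun n x => R (r^[n + 1] x) b) hA
      (fun n x y hx => by
        rw [(hr.iterate (n + 1)).2 x y]
        exact ⟨fun h => hR.trans hx (hR.symm h), fun h => hR.trans (hR.symm h) hx⟩)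
      (fun m n x hm hn => by
        have h₁ := hnot m n x hm hn
        have h₂ := hnot n m x hn hm
        omega) hne
    exact ⟨_, (hr.iterate (n + 1)).comp hF, hn⟩
  · push Not at hne
    obtain ⟨n, hn⟩ := hne
    exact ⟨_, hr.iterate (n + 1), hn⟩

theorem avoidable_of_noncomputable (hR : Equivalence R)
    (h : ∀ a, (¬ ComputablePred fun z => R z a) → Avoidable R a)
    {b : ℕ} (hb : ¬ ComputablePred fun z => R z b) (a : ℕ) : Avoidable R a := by
  classical
  by_cases ha : ComputablePred fun z => R z a
  · obtain ⟨g, hg, hgb⟩ := h b hb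
    refine ⟨fun x => if R (g x) a then b else g x,
      ⟨ComputablePred.ite (Computable.const b) hg.1 (ha.comp' hg.1), fun x y => ?_⟩, fun x => ?_⟩
    · rw [hg.2 x y]
      have hx := hgb x
      have hy := hgb y
      have := @hR.symm
      have := @hR.trans
      have := hR.refl b
      dsimp only
      split_ifs <;> grind
    · have hba : ¬ R b a := fun hba => hb <| ha.of_eq fun z =>
        ⟨fun hz => hR.trans hz (hR.symm hba), fun hz => hR.trans hz hba⟩
      dsimp only
      split_ifs with hx
      exacts [hba, hx]
  · exact h a ha

theorem exists_avoiding_finset (hR : Equivalence R) (h : ∀ a, Avoidable R a) (F : Finset ℕ) :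
    ∃ g, IsRed R R g ∧ ∀ a ∈ F, ∀ x, ¬ R (g x) a := by
  classical
  induction F using Finset.induction_on with
  | empty => exact ⟨id, ⟨Computable.id, fun _ _ => Iff.rfl⟩, by simp⟩
  | insert a F _ ih =>
    obtain ⟨g, hg, hgF⟩ := ih
    by_cases hc : ∃ c, R (g c) a
    · obtain ⟨c, hc⟩ := hc
      obtain ⟨k, hk, hkc⟩ := h c
      refine ⟨g ∘ k, hg.comp hk, fun d hd x hx => ?_⟩
      rcases Finset.mem_insert.1 hd with rfl | hd
      · exact hkc x ((hg.2 _ _).2 (hR.trans hx (hR.symm hc)))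
      · exact hgF d hd _ hx
    · refine ⟨g, hg, fun d hd => ?_⟩
      rcases Finset.mem_insert.1 hd with rfl | hd
      exacts [not_exists.1 hc, hgF d hd]

end Avoiding

/-! ### Joins and upper bounds -/

section Joins

variable {R S : ℕ → ℕ → Prop}

@[simp] theorem join_even_even (x y : ℕ) : Join R S (2 * x) (2 * y) ↔ R x y := by
  refine ⟨?_, fun h => Or.inl ⟨x, y, rfl, rfl, h⟩⟩
  rintro (⟨a, b, h₁, h₂, h⟩ | ⟨a, b, h₁, h₂, h⟩)
  · obtain rfl : x = a := by omega
    obtain rfl : y = b := by omega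
    exact h
  · omega

@[simp] theorem join_odd_odd (x y : ℕ) : Join R S (2 * x + 1) (2 * y + 1) ↔ S x y := by
  refine ⟨?_, fun h => Or.inr ⟨x, y, rfl, rfl, h⟩⟩
  rintro (⟨a, b, h₁, h₂, h⟩ | ⟨a, b, h₁, h₂, h⟩)
  · omega
  · obtain rfl : x = a := by omega
    obtain rfl : y = b := by omega
    exact h

@[simp] theorem join_even_odd (x y : ℕ) : ¬ Join R S (2 * x) (2 * y + 1) := by
  rintro (⟨a, b, h₁, h₂, h⟩ | ⟨a, b, h₁, h₂, h⟩) <;> omega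

@[simp] theorem join_odd_even (x y : ℕ) : ¬ Join R S (2 * x + 1) (2 * y) := by
  rintro (⟨a, b, h₁, h₂, h⟩ | ⟨a, b, h₁, h₂, h⟩) <;> omega

theorem join_equivalence (hR : Equivalence R) (hS : Equivalence S) : Equivalence (Join R S) where
  refl n := by
    obtain ⟨x, rfl | rfl⟩ := n.even_or_odd'
    · simpa using hR.refl x
    · simpa using hS.refl x
  symm := by
    rintro _ _ (⟨x, y, rfl, rfl, h⟩ | ⟨x, y, rfl, rfl, h⟩)
    · simpa using hR.symm h
    · simpa using hS.symm h
  trans := by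
    rintro _ _ c (⟨x, y, rfl, rfl, h⟩ | ⟨x, y, rfl, rfl, h⟩) h' <;>
      obtain ⟨z, rfl | rfl⟩ := c.even_or_odd'
    · simp only [join_even_even] at h' ⊢
      exact hR.trans h h'
    · simp at h'
    · simp at h'
    · simp only [join_odd_odd] at h' ⊢
      exact hS.trans h h'

theorem isRed_join_left : IsRed R (Join R S) fun x => 2 * x :=
  ⟨computable_two_mul, fun x y => by simp⟩

theorem isRed_join_right : IsRed S (Join R S) fun x => 2 * x + 1 :=
  ⟨computable_two_mul_add_one, fun x y => by simp⟩

/-- The disjoint sum of `R` and the `ψ`-pullback of `R`, with `y` on the right glued to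
`ψ y` on the left. -/
def Glue (R : ℕ → ℕ → Prop) (ψ : ℕ → ℕ) : ℕ → ℕ → Prop :=
  fun m n => R (merge id ψ m) (merge id ψ n)

theorem glue_equivalence (hR : Equivalence R) (ψ : ℕ → ℕ) : Equivalence (Glue R ψ) :=
  ⟨fun _ => hR.refl _, hR.symm, hR.trans⟩

theorem isRed_glue_left (ψ : ℕ → ℕ) : IsRed R (Glue R ψ) fun x => 2 * x :=
  ⟨computable_two_mul, fun x y => by simp [Glue]⟩

theorem isRed_glue_right {ψ : ℕ → ℕ} (hψ : ∀ x y, S x y ↔ R (ψ x) (ψ y)) :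
    IsRed S (Glue R ψ) fun x => 2 * x + 1 :=
  ⟨computable_two_mul_add_one, fun x y => by simpa [Glue] using hψ x y⟩

theorem IsRed.merge_of_disjoint {U : ℕ → ℕ → Prop} {f g : ℕ → ℕ} (hU : Equivalence U)
    (hf : IsRed R U f) (hg : IsRed S U g) (hfg : ∀ x y, ¬ U (f x) (g y)) :
    IsRed (Join R S) U (merge f g) := by
  refine ⟨hf.1.merge hg.1, fun m n => ?_⟩
  obtain ⟨x, rfl | rfl⟩ := m.even_or_odd' <;> obtain ⟨y, rfl | rfl⟩ := n.even_or_odd'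
  · simpa using hf.2 x y
  · simpa using hfg x y
  · simpa using fun h => hfg y x (hU.symm h)
  · simpa using hg.2 x y

theorem IsRed.merge_of_glued {U : ℕ → ℕ → Prop} {k g ψ : ℕ → ℕ} (hU : Equivalence U)
    (hk : IsRed R U k) (hg : Computable g) (hkg : ∀ y, U (k (ψ y)) (g y)) :
    IsRed (Glue R ψ) U (merge k g) := by
  have key : ∀ m, U (merge k g m) (k (merge id ψ m)) := fun m => by
    obtain ⟨x, rfl | rfl⟩ := m.even_or_odd'
    · simpa using hU.refl _
    · simpa using hU.symm (hkg x)
  refine ⟨hk.1.merge hg, fun m n => (hk.2 _ _).trans ⟨fun h => ?_, fun h => ?_⟩⟩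
  · exact hU.trans (key m) (hU.trans h (hU.symm (key n)))
  · exact hU.trans (hU.symm (key m)) (hU.trans h (key n))

/-! ### Finite equivalence relations -/

theorem finite_quotient_of_classes (hS : Equivalence S) (hfin : (classes S).Finite) :
    Finite (Quotient ⟨S, hS⟩) := by
  have := hfin.to_subtype
  refine Finite.of_injective (β := classes S)
    (Quotient.lift (s := ⟨S, hS⟩) (fun a => (⟨{z | S z a}, a, rfl⟩ : classes S)) ?_) ?_
  · intro a b hab
    exact Subtype.ext <| Set.ext fun z => ⟨fun h => hS.trans h hab, fun h => hS.trans h (hS.symm hab)⟩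
  · intro p q
    induction p using Quotient.inductionOn
    induction q using Quotient.inductionOn
    rename_i a b
    intro h
    have h' : {z | S z a} = {z | S z b} := congrArg Subtype.val h
    have : a ∈ {z | S z b} := h' ▸ hS.refl a
    exact Quotient.sound this

theorem exists_finset_representatives (hS : Equivalence S) (hfin : Finite (Quotient ⟨S, hS⟩)) :
    ∃ Y : Finset ℕ, ∀ y, ∃ a ∈ Y, S y a := by
  have := Set.finite_range (Quotient.out : Quotient ⟨S, hS⟩ → ℕ)
  refine ⟨this.toFinset, fun y => ⟨(Quotient.mk ⟨S, hS⟩ y).out, by simp, ?_⟩⟩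
  exact hS.symm (Quotient.exact (Quotient.out_eq (Quotient.mk ⟨S, hS⟩ y)))

theorem exists_map_of_embedding (hR : Equivalence R) (hS : Equivalence S)
    (e : Quotient ⟨S, hS⟩ ↪ Quotient ⟨R, hR⟩) : ∃ ψ : ℕ → ℕ, ∀ x y, S x y ↔ R (ψ x) (ψ y) := by
  refine ⟨fun y => (e (Quotient.mk _ y)).out, fun x y => ?_⟩
  rw [show S x y ↔ Quotient.mk ⟨S, hS⟩ x = Quotient.mk ⟨S, hS⟩ y from
    (Quotient.eq (r := ⟨S, hS⟩)).symm, ← e.injective.eq_iff, ← Quotient.out_equiv_out]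
  rfl

/-- A relation with finitely many classes, all computable, reduces to any relation with at
least as many classes. -/
theorem exists_isRed_of_computable_classes (hS : Equivalence S)
    (hc : ∀ a, ComputablePred fun z => R z a) {Y : Finset ℕ} (hY : ∀ y, ∃ a ∈ Y, R y a)
    {ψ : ℕ → ℕ} (hψ : ∀ x y, R x y ↔ S (ψ x) (ψ y)) : ∃ k, IsRed R S k := by
  classical
  have key : ∀ Z : Finset ℕ, ∃ k : ℕ → ℕ, Computable k ∧ ∀ a ∈ Z, ∀ x, R x a → S (k x) (ψ x) := by
    intro Z
    induction Z using Finset.induction_on with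
    | empty => exact ⟨id, Computable.id, by simp⟩
    | insert a Z _ ih =>
      obtain ⟨k, hk, hkZ⟩ := ih
      refine ⟨fun x => if R x a then ψ a else k x,
        ComputablePred.ite (Computable.const _) hk (hc a), fun b hb x hx => ?_⟩
      dsimp only
      split_ifs with h
      · exact hS.symm ((hψ x a).1 h)
      · rcases Finset.mem_insert.1 hb with rfl | hb
        exacts [absurd hx h, hkZ b hb x hx]
  obtain ⟨k, hk, hkY⟩ := key Y
  have hkψ : ∀ x, S (k x) (ψ x) := fun x => by
    obtain ⟨a, ha, hxa⟩ := hY x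
    exact hkY a ha x hxa
  refine ⟨k, hk, fun x y => (hψ x y).trans ⟨fun h => ?_, fun h => ?_⟩⟩
  · exact hS.trans (hkψ x) (hS.trans h (hS.symm (hkψ y)))
  · exact hS.trans (hS.symm (hkψ x)) (hS.trans h (hkψ y))

/-- If all classes of `R` are computable, a reduction of `R` to `U` can be rearranged so that
finitely many classes have prescribed images. -/
theorem exists_isRed_prescribed {U : ℕ → ℕ → Prop} (hR : Equivalence R) (hU : Equivalence U)
    (hS : Equivalence S)
    (hc : ∀ a, ComputablePred fun z => R z a) {f g ψ : ℕ → ℕ} (hf : IsRed R U f)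
    (hg : ∀ x y, S x y ↔ U (g x) (g y)) (hψ : ∀ x y, S x y ↔ R (ψ x) (ψ y)) (Y : Finset ℕ) :
    ∃ k, IsRed R U k ∧ ∀ y ∈ Y, U (k (ψ y)) (g y) := by
  classical
  induction Y using Finset.induction_on with
  | empty => exact ⟨f, hf, by simp⟩
  | insert a Y _ ih =>
    obtain ⟨k, hk, hkY⟩ := ih
    have hUs := @hU.symm
    have hUt := @hU.trans
    have hRs := @hR.symm
    have hRt := @hR.trans
    have hRr := hR.refl
    have hUr := hU.refl
    have hk2 := hk.2
    by_cases hex : ∃ c, U (k c) (g a)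
    · obtain ⟨c, hca⟩ := hex
      refine ⟨fun x => if R x (ψ a) then g a else if R x c then k (ψ a) else k x,
        ⟨ComputablePred.ite (Computable.const _) (ComputablePred.ite (Computable.const _) hk.1 (hc _))
          (hc _), fun x y => ?_⟩, fun y hy => ?_⟩
      · dsimp only
        split_ifs <;> grind
      · dsimp only
        by_cases hya : S y a
        · rw [if_pos ((hψ _ _).1 hya)]
          exact hU.symm ((hg _ _).1 hya)
        · have hyY : y ∈ Y := (Finset.mem_insert.1 hy).resolve_left
            (by rintro rfl; exact hya (hS.refl _))
          rw [if_neg (fun h => hya ((hψ _ _).2 h)), if_neg]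
          · exact hkY y hyY
          · intro h
            refine hya ((hg _ _).2 ?_)
            exact hU.trans (hU.symm (hkY y hyY)) (hU.trans ((hk.2 _ _).1 h) hca)
    · push Not at hex
      refine ⟨fun x => if R x (ψ a) then g a else k x,
        ⟨ComputablePred.ite (Computable.const _) hk.1 (hc _), fun x y => ?_⟩, fun y hy => ?_⟩
      · dsimp only
        split_ifs <;> grind
      · dsimp only
        by_cases hya : S y a
        · rw [if_pos ((hψ _ _).1 hya)]
          exact hU.symm ((hg _ _).1 hya)
        · rw [if_neg (fun h => hya ((hψ _ _).2 h))]
          exact hkY y ((Finset.mem_insert.1 hy).resolve_left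
            (by rintro rfl; exact hya (hS.refl _)))

/-! ### Least upper bounds from avoidance -/

theorem exists_lub_of_avoidable (hR : Equivalence R) (hS : Equivalence S)
    (hfin : (classes S).Finite) (h : ∀ a, Avoidable R a) :
    ∃ T : ℕ → ℕ → Prop, Equivalence T ∧ IsLub' R S T := by
  classical
  obtain ⟨Y, hY⟩ := exists_finset_representatives hS (finite_quotient_of_classes hS hfin)
  refine ⟨Join R S, join_equivalence hR hS, ⟨_, isRed_join_left⟩, ⟨_, isRed_join_right⟩, ?_⟩
  rintro U hU ⟨f, hf⟩ ⟨g, hg⟩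
  replace hf : IsRed R U f := hf
  replace hg : IsRed S U g := hg
  have hc : ∀ y, ∃ c, (∃ x, U (f x) (g y)) → U (f c) (g y) := fun y => by
    by_cases hx : ∃ x, U (f x) (g y)
    · exact hx.imp fun x hx _ => hx
    · exact ⟨0, fun h => absurd h hx⟩
  choose c hc using hc
  obtain ⟨k, hk, hkY⟩ := exists_avoiding_finset hR h (Y.image c)
  refine ⟨_, (hf.comp hk).merge_of_disjoint hU hg fun x y hxy => ?_⟩
  obtain ⟨a, ha, hya⟩ := hY y
  have hxa : U (f (k x)) (g a) := hU.trans hxy ((hg.2 _ _).1 hya)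
  exact hkY _ (Finset.mem_image_of_mem _ ha) x
    ((hf.2 _ _).2 (hU.trans hxa (hU.symm (hc a ⟨_, hxa⟩))))

theorem exists_lub_of_computable_classes (hR : Equivalence R) (hS : Equivalence S)
    (hfin : (classes S).Finite) (hc : ∀ a, ComputablePred fun z => R z a) :
    ∃ T : ℕ → ℕ → Prop, Equivalence T ∧ IsLub' R S T := by
  have hSfin := finite_quotient_of_classes hS hfin
  rcases Function.Embedding.total (Quotient ⟨S, hS⟩) (Quotient ⟨R, hR⟩) with ⟨⟨e⟩⟩ | ⟨⟨e⟩⟩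
  · obtain ⟨ψ, hψ⟩ := exists_map_of_embedding hR hS e
    obtain ⟨Y, hY⟩ := exists_finset_representatives hS hSfin
    refine ⟨Glue R ψ, glue_equivalence hR ψ, ⟨_, isRed_glue_left ψ⟩, ⟨_, isRed_glue_right hψ⟩, ?_⟩
    rintro U hU ⟨f, hf⟩ ⟨g, hg⟩
    obtain ⟨k, hk, hkY⟩ := exists_isRed_prescribed hR hU hS hc hf hg.2 hψ Y
    refine ⟨_, hk.merge_of_glued hU hg.1 fun y => ?_⟩
    obtain ⟨a, ha, hya⟩ := hY y
    exact hU.trans ((hk.2 _ _).1 ((hψ _ _).1 hya))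
      (hU.trans (hkY a ha) (hU.symm ((hg.2 _ _).1 hya)))
  · obtain ⟨ψ, hψ⟩ := exists_map_of_embedding hS hR e
    obtain ⟨Y, hY⟩ := exists_finset_representatives hR (Finite.of_injective e e.injective)
    exact ⟨S, hS, exists_isRed_of_computable_classes hS hc hY hψ,
      ⟨id, Computable.id, fun _ _ => Iff.rfl⟩, fun U _ _ hSU => hSU⟩

end Joins

/-! ### Avoidance from least upper bounds -/

/-- Diagonalization: some set disagrees, for each of countably many pairs `(W, V)` with `W`
infinite, with `V` at a point of `W`. -/
theorem exists_diagonal_set {F : Set (Set ℕ × Set ℕ)} (hF : F.Countable) :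
    ∃ C : Set ℕ, ∀ p ∈ F, p.1.Infinite → ∃ w ∈ p.1, (w ∈ C ↔ w ∉ p.2) := by
  set G : Set (Set ℕ × Set ℕ) := {p ∈ F | p.1.Infinite}
  have hGc : G.Countable := hF.mono fun p hp => hp.1
  rcases G.eq_empty_or_nonempty with h | h
  · refine ⟨∅, fun p hp hinf => ?_⟩
    exact absurd (show p ∈ G from ⟨hp, hinf⟩) (h ▸ Set.notMem_empty p)
  · obtain ⟨s, hs⟩ := hGc.exists_eq_range h
    have hfreq : ∀ n, ∃ᶠ k in Filter.atTop, k ∈ (s n).1 := fun n =>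
      Nat.frequently_atTop_iff_infinite.2 (show s n ∈ G from hs ▸ ⟨n, rfl⟩).2
    obtain ⟨φ, hφ, hφs⟩ := Filter.extraction_forall_of_frequently hfreq
    refine ⟨{w | ∃ n, w = φ n ∧ w ∉ (s n).2}, fun p hp hinf => ?_⟩
    obtain ⟨n, rfl⟩ : p ∈ Set.range s := hs ▸ (show p ∈ G from ⟨hp, hinf⟩)
    refine ⟨φ n, hφs n, ?_, fun h => ⟨n, rfl, h⟩⟩
    rintro ⟨m, hm, h⟩
    obtain rfl := hφ.injective hm
    exact h

/-- A set in general position with respect to the countably many sets computable from `R`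
in the ways needed below. -/
structure Generic (R : ℕ → ℕ → Prop) (C : Set ℕ) : Prop where
  even_ne : ∀ φ, Computable φ → {y | φ y % 2 = 0}.Infinite → ∀ a,
    ∃ y, φ y % 2 = 0 ∧ (y ∈ C ↔ ¬ R (φ y / 2) a)
  even_mem : ∀ φ, Computable φ → {y | φ y % 2 = 0}.Infinite → ∃ y, φ y % 2 = 0 ∧ y ∈ C
  exists_mem : ∀ n, ∃ y, n ≤ y ∧ y ∈ C
  exists_notMem : ∀ n, ∃ y, n ≤ y ∧ y ∉ C
  odd_ne : ∀ φ, Computable φ → {z | ∃ x, φ x = 2 * z + 1}.Infinite → ∀ a,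
    ∃ z, (∃ x, φ x = 2 * z + 1) ∧ (z ∈ C ↔ ¬ ∃ x, φ x = 2 * z + 1 ∧ R x a)
  odd_ne_compl : ∀ φ, Computable φ → {z | ∃ x, φ x = 2 * z + 1}.Infinite → ∀ a,
    ∃ z, (∃ x, φ x = 2 * z + 1) ∧ (z ∈ C ↔ ∃ x, φ x = 2 * z + 1 ∧ R x a)

theorem exists_generic (R : ℕ → ℕ → Prop) : ∃ C, Generic R C := by
  let ι := {φ : ℕ → ℕ // Computable φ} × ℕ
  let E : ι → Set ℕ := fun i => {y | i.1.1 y % 2 = 0}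
  let O : ι → Set ℕ := fun i => {z | ∃ x, i.1.1 x = 2 * z + 1}
  let A : ι → Set ℕ := fun i => {z | ∃ x, i.1.1 x = 2 * z + 1 ∧ R x i.2}
  let s : ι ⊕ ι ⊕ ℕ ⊕ ℕ ⊕ ι ⊕ ι → Set ℕ × Set ℕ :=
    Sum.elim (fun i => (E i, {y | R (i.1.1 y / 2) i.2})) <|
    Sum.elim (fun i => (E i, ∅)) <|
    Sum.elim (fun n => (Set.Ici n, ∅)) <|
    Sum.elim (fun n => (Set.Ici n, Set.univ)) <|
    Sum.elim (fun i => (O i, A i)) fun i => (O i, (A i)ᶜ)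
  obtain ⟨C, hC⟩ := exists_diagonal_set (Set.countable_range s)
  replace hC := fun j => hC (s j) ⟨j, rfl⟩
  refine ⟨C, ⟨fun φ hφ h a => ?_, fun φ hφ h => ?_, fun n => ?_, fun n => ?_, fun φ hφ h a => ?_,
    fun φ hφ h a => ?_⟩⟩
  · exact hC (.inl (⟨φ, hφ⟩, a)) h
  · obtain ⟨w, hw, hw'⟩ := hC (.inr (.inl (⟨φ, hφ⟩, 0))) h
    exact ⟨w, hw, hw'.2 (Set.notMem_empty w)⟩
  · obtain ⟨w, hw, hw'⟩ := hC (.inr (.inr (.inl n))) (Set.Ici_infinite n)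
    exact ⟨w, hw, hw'.2 (Set.notMem_empty w)⟩
  · obtain ⟨w, hw, hw'⟩ := hC (.inr (.inr (.inr (.inl n)))) (Set.Ici_infinite n)
    exact ⟨w, hw, fun h => hw'.1 h (Set.mem_univ w)⟩
  · exact hC (.inr (.inr (.inr (.inr (.inl (⟨φ, hφ⟩, a)))))) h
  · obtain ⟨w, hw, hw'⟩ := hC (.inr (.inr (.inr (.inr (.inr (⟨φ, hφ⟩, a)))))) h
    exact ⟨w, hw, hw'.trans Set.notMem_compl_iff⟩

/-- The equivalence relation with classes `C` and its complement. -/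
def SameSide (C : Set ℕ) : ℕ → ℕ → Prop := fun x y => x ∈ C ↔ y ∈ C

theorem sameSide_equivalence (C : Set ℕ) : Equivalence (SameSide C) :=
  ⟨fun _ => Iff.rfl, Iff.symm, Iff.trans⟩

theorem finite_classes_sameSide (C : Set ℕ) : (classes (SameSide C)).Finite := by
  refine (Set.toFinite {C, Cᶜ}).subset ?_
  rintro _ ⟨a, rfl⟩
  by_cases ha : a ∈ C
  · left; ext z; simp [SameSide, ha]
  · right; ext z; simp [SameSide, ha]

namespace Generic

variable {R : ℕ → ℕ → Prop} {C : Set ℕ}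

theorem exists_sameSide (hC : Generic R C) (n y : ℕ) : ∃ z, n ≤ z ∧ SameSide C y z := by
  by_cases hy : y ∈ C
  · obtain ⟨z, hz, hzC⟩ := hC.exists_mem n
    exact ⟨z, hz, iff_of_true hy hzC⟩
  · obtain ⟨z, hz, hzC⟩ := hC.exists_notMem n
    exact ⟨z, hz, iff_of_false hy hzC⟩

/-- Reductions of a generic relation to a join stay in the right half. -/
theorem odd_of_isRed_join (hC : Generic R C) {v : ℕ → ℕ}
    (hv : IsRed (SameSide C) (Join R (SameSide C)) v) (y : ℕ) : ∃ z, v y = 2 * z + 1 := by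
  have hfin : {y | v y % 2 = 0}.Finite := by
    by_contra hinf
    obtain ⟨c, -, hc⟩ := hC.exists_mem 0
    obtain ⟨k, hk | hk⟩ := (v c).even_or_odd'
    · obtain ⟨y, hy, hyC⟩ := hC.even_ne v hv.1 hinf k
      have hy' : v y = 2 * (v y / 2) := by omega
      have h := hv.2 y c
      rw [hy', hk, join_even_even] at h
      simp only [SameSide, hc, iff_true] at h
      tauto
    · obtain ⟨y, hy, hyC⟩ := hC.even_mem v hv.1 hinf
      have hy' : v y = 2 * (v y / 2) := by omega
      have h := (hv.2 y c).1 (iff_of_true hyC hc)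
      rw [hy', hk] at h
      exact join_even_odd _ _ h
  obtain ⟨N, hN⟩ := hfin.bddAbove
  obtain ⟨z, hz, hyz⟩ := hC.exists_sameSide (N + 1) y
  obtain ⟨k, hk | hk⟩ := (v z).even_or_odd'
  · have : z ≤ N := hN (show v z % 2 = 0 by omega)
    omega
  · have h := (hv.2 y z).1 hyz
    obtain ⟨l, hl | hl⟩ := (v y).even_or_odd'
    · rw [hl, hk] at h
      exact absurd h (join_even_odd _ _)
    · exact ⟨l, hl⟩

/-- Reductions of a generic relation to a gluing along two classes reach the first of them. -/
theorem exists_hit_of_isRed_glue (hC : Generic R C) (hR : Equivalence R) {ψ v : ℕ → ℕ} {b c : ℕ}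
    (hv : IsRed (SameSide C) (Glue R ψ) v) (hψ : ∀ z, ψ z = b ∨ ψ z = c) :
    ∃ y, R (merge id ψ (v y)) b := by
  have hfin : {y | v y % 2 = 0}.Finite := by
    by_contra hinf
    obtain ⟨d, -, hd⟩ := hC.exists_mem 0
    obtain ⟨y, hy, hyC⟩ := hC.even_ne v hv.1 hinf (merge id ψ (v d))
    have hy' : v y = 2 * (v y / 2) := by omega
    have h := hv.2 y d
    rw [Glue, hy', merge_even] at h
    simp only [SameSide, hd, iff_true, id] at h
    tauto
  obtain ⟨N, hN⟩ := hfin.bddAbove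
  have hodd : ∀ z, N + 1 ≤ z → ∃ k, v z = 2 * k + 1 := fun z hz => by
    obtain ⟨k, hk | hk⟩ := (v z).even_or_odd'
    · have : z ≤ N := hN (show v z % 2 = 0 by omega)
      omega
    · exact ⟨k, hk⟩
  obtain ⟨y, hy, hyC⟩ := hC.exists_mem (N + 1)
  obtain ⟨z, hz, hzC⟩ := hC.exists_notMem (N + 1)
  obtain ⟨k, hk⟩ := hodd y hy
  obtain ⟨l, hl⟩ := hodd z hz
  have hne : ¬ R (ψ k) (ψ l) := fun h => by
    have := (hv.2 y z).2 (by simpa [Glue, hk, hl] using h)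
    exact hzC (this.1 hyC)
  rcases hψ k with h | h
  · exact ⟨y, by simpa [hk, h] using hR.refl b⟩
  · rcases hψ l with h' | h'
    · exact ⟨z, by simpa [hl, h'] using hR.refl b⟩
    · exact absurd (by rw [h, h']; exact hR.refl c) hne

/-- Under a reduction of `R` to its join with a generic relation, classes that are mapped
into the right half are computable. -/
theorem computablePred_class (hC : Generic R C) {u : ℕ → ℕ} (hu : IsRed R (Join R (SameSide C)) u)
    {x₀ z₀ : ℕ} (hx₀ : u x₀ = 2 * z₀ + 1) : ComputablePred fun x => R x x₀ := by
  have hodd : ∀ x z, u x = 2 * z + 1 → (R x x₀ ↔ (z ∈ C ↔ z₀ ∈ C)) := fun x z h => by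
    rw [hu.2, h, hx₀, join_odd_odd, SameSide]
  have hfin : {z | ∃ x, u x = 2 * z + 1}.Finite := by
    by_contra hinf
    by_cases hz₀ : z₀ ∈ C
    · obtain ⟨w, ⟨x, hx⟩, hw⟩ := hC.odd_ne u hu.1 hinf x₀
      by_cases hwC : w ∈ C
      · exact hw.1 hwC ⟨x, hx, (hodd x w hx).2 (iff_of_true hwC hz₀)⟩
      · obtain ⟨x', hx', hxR⟩ := not_not.1 fun h => hwC (hw.2 h)
        exact hwC (((hodd x' w hx').1 hxR).2 hz₀)
    · obtain ⟨w, ⟨x, hx⟩, hw⟩ := hC.odd_ne_compl u hu.1 hinf x₀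
      by_cases hwC : w ∈ C
      · obtain ⟨x', hx', hxR⟩ := hw.1 hwC
        exact hz₀ (((hodd x' w hx').1 hxR).1 hwC)
      · exact hwC (hw.2 ⟨x, hx, (hodd x w hx).2 (iff_of_false hwC hz₀)⟩)
  refine ((computablePred_even.comp' hu.1).not.and' ((ComputablePred.of_finite
    (hfin.subset (t := {z | (∃ x, u x = 2 * z + 1) ∧ (z ∈ C ↔ z₀ ∈ C)}) fun z hz => hz.1)).comp'
    (computable_half.comp hu.1))).of_eq fun x => ?_
  obtain ⟨z, hz | hz⟩ := (u x).even_or_odd'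
  · refine iff_of_false (fun h => h.1 (by omega)) fun h => ?_
    rw [hu.2, hz, hx₀] at h
    exact join_even_odd _ _ h
  · have hz' : u x / 2 = z := by omega
    rw [hodd x z hz]
    simp only [hz', Set.mem_ofPred_eq]
    exact ⟨fun h => h.2.2, fun h => ⟨by omega, ⟨x, hz⟩, h⟩⟩

end Generic

theorem avoidable_of_lub {R : ℕ → ℕ → Prop} (hR : Equivalence R) {C : Set ℕ} (hC : Generic R C)
    (hlub : ∃ T : ℕ → ℕ → Prop, Equivalence T ∧ IsLub' R (SameSide C) T)
    {b : ℕ} (hb : ¬ ComputablePred fun z => R z b) : Avoidable R b := by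
  classical
  obtain ⟨c, hcb⟩ : ∃ c, ¬ R c b := by
    by_contra! h
    exact hb ((PrimrecPred.toComputablePred (Primrec.eq.comp Primrec.id Primrec.id)).of_eq
      fun z => by simpa using h z)
  set ψ : ℕ → ℕ := fun z => if z ∈ C then b else c with hψ
  have hψred : ∀ x y, SameSide C x y ↔ R (ψ x) (ψ y) := fun x y => by
    have hbc : ¬ R b c := fun h => hcb (hR.symm h)
    by_cases hx : x ∈ C <;> by_cases hy : y ∈ C <;>
      simp [SameSide, hψ, hx, hy, hR.refl b, hR.refl c, hcb, hbc]
  have hψval : ∀ z, ψ z = b ∨ ψ z = c := fun z => by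
    by_cases hz : z ∈ C <;> simp [hψ, hz]
  obtain ⟨T, -, ⟨f, hf⟩, ⟨g, hg⟩, hT⟩ := hlub
  obtain ⟨h, hh⟩ := hT _ (join_equivalence hR (sameSide_equivalence C)) ⟨_, isRed_join_left⟩
    ⟨_, isRed_join_right⟩
  obtain ⟨k, hk⟩ := hT _ (glue_equivalence hR ψ) ⟨_, isRed_glue_left ψ⟩
    ⟨_, isRed_glue_right hψred⟩
  have hu : IsRed R (Join R (SameSide C)) (h ∘ f) := IsRed.comp hh hf
  have hv : IsRed (SameSide C) (Join R (SameSide C)) (h ∘ g) := IsRed.comp hh hg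
  have hu' : IsRed R (Glue R ψ) (k ∘ f) := IsRed.comp hk hf
  have hv' : IsRed (SameSide C) (Glue R ψ) (k ∘ g) := IsRed.comp hk hg
  obtain ⟨y, hy⟩ := hC.exists_hit_of_isRed_glue hR hv' hψval
  set ρ : ℕ → ℕ := fun x => merge id ψ (k (f x)) with hρ
  have hρred : ∀ x y, R x y ↔ R (ρ x) (ρ y) := hu'.2
  have hP : ComputablePred fun x => R (ρ x) b := by
    by_cases hex : ∃ x, R (ρ x) b
    · obtain ⟨x, hx⟩ := hex
      have hT' : T (f x) (g y) := (hk.2 _ _).2 (hR.trans hx (hR.symm hy))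
      have hJ : Join R (SameSide C) (h (f x)) (h (g y)) := (hh.2 _ _).1 hT'
      obtain ⟨z, hz⟩ := hC.odd_of_isRed_join hv y
      obtain ⟨w, hw | hw⟩ := (h (f x)).even_or_odd'
      · rw [hw, show h (g y) = 2 * z + 1 from hz] at hJ
        exact absurd hJ (join_even_odd _ _)
      · refine (hC.computablePred_class hu hw).of_eq fun x' => ?_
        rw [hρred]
        exact ⟨fun h' => hR.trans h' hx, fun h' => hR.trans h' (hR.symm hx)⟩
    · exact (ComputablePred.mem_finset ∅).of_eq fun x => by simpa using not_exists.1 hex x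
  set r : ℕ → ℕ := fun x => if R (ρ x) b then b else merge id (fun _ => c) (k (f x)) with hr
  have hrρ : ∀ x, R (r x) (ρ x) := fun x => by
    by_cases hx : R (ρ x) b
    · simpa [hr, hx] using hR.symm hx
    · simp only [hr, hx, if_false]
      obtain ⟨z, hz | hz⟩ := (k (f x)).even_or_odd'
      · simpa [hρ, hz] using hR.refl z
      · rcases hψval z with h' | h'
        · exact absurd (by simpa [hρ, hz, h'] using hR.refl b) hx
        · simpa [hρ, hz, h'] using hR.refl c
  refine avoidable_of_computable_preimage hR hb (r := r) ⟨?_, fun x y => ?_⟩ (hP.of_eq fun x => ?_)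
  · exact ComputablePred.ite (Computable.const b)
      ((Computable.id.merge (Computable.const c)).comp hu'.1) hP
  · rw [hρred]
    exact ⟨fun h' => hR.trans (hrρ x) (hR.trans h' (hR.symm (hrρ y))),
      fun h' => hR.trans (hR.symm (hrρ x)) (hR.trans h' (hrρ y))⟩
  · exact ⟨fun h' => hR.trans (hrρ x) h', fun h' => hR.trans (hR.symm (hrρ x)) h'⟩

theorem stmt_14 (R : ℕ → ℕ → Prop) (hR : Equivalence R) :
    NCA R ↔ ∀ S : ℕ → ℕ → Prop, Equivalence S → (classes S).Finite →
      ∃ T : ℕ → ℕ → Prop, Equivalence T ∧ IsLub' R S T := by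
  constructor
  · intro h S hS hfin
    by_cases hc : ∀ a, ComputablePred fun z => R z a
    · exact exists_lub_of_computable_classes hR hS hfin hc
    · push Not at hc
      obtain ⟨b, hb⟩ := hc
      refine exists_lub_of_avoidable hR hS hfin (avoidable_of_noncomputable hR (fun a ha => ?_) hb)
      obtain ⟨g, hg, hgR, hga⟩ := h {a} (by simpa using ha)
      exact ⟨g, ⟨hg, hgR⟩, hga a (by simp)⟩
  · intro h F hF
    obtain ⟨C, hC⟩ := exists_generic R
    have hlub := h _ (sameSide_equivalence C) (finite_classes_sameSide C)
    rcases F.eq_empty_or_nonempty with rfl | ⟨b, hbF⟩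
    · exact ⟨id, Computable.id, fun _ _ => Iff.rfl, by simp⟩
    · obtain ⟨g, hg, hgF⟩ := exists_avoiding_finset hR
        (avoidable_of_noncomputable hR (fun a ha => avoidable_of_lub hR hC hlub ha) (hF b hbF)) F
      exact ⟨g, hg.1, hg.2, hgF⟩
end

section
/- An equivalence relation R on ℕ satisfies R ≡c Id if and only if R is noncomputably avoiding, R has infinitely many equivalence classes, and every equivalence relation S with S <c R has only finitely many equivalence classes. -/
theorem CompRed.trans {R S T : ℕ → ℕ → Prop} (h₁ : CompRed R S) (h₂ : CompRed S T) :
    CompRed R T := by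
  obtain ⟨f, hf, hfr⟩ := h₁
  obtain ⟨g, hg, hgr⟩ := h₂
  exact ⟨fun x => g (f x), hg.comp hf, fun x y => (hfr x y).trans (hgr _ _)⟩

theorem computable_iterate {f : ℕ → ℕ} (hf : Computable f) (a : ℕ) :
    Computable fun n => f^[n] a := by
  have h : Computable fun n : ℕ =>
      (Nat.rec a (fun _ v => f v) n : ℕ) :=
    Computable.nat_rec (f := fun n : ℕ => n) (g := fun _ => a)
      (h := fun _ (p : ℕ × ℕ) => f p.2)
      Computable.id (Computable.const a) (hf.comp (Computable.snd.comp Computable.snd)).to₂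
  refine h.of_eq fun n => ?_
  induction n with
  | zero => rfl
  | succ n ih => rw [Function.iterate_succ_apply', ← ih]

/-- A self-reduction that misses the class of `a` yields a reduction of the identity:
the orbit of `a` consists of pairwise inequivalent elements. -/
theorem compRed_idEq_of_avoids {R : ℕ → ℕ → Prop} (hR : Equivalence R) {f : ℕ → ℕ}
    (hf : Computable f) (hfr : ∀ x y, R x y ↔ R (f x) (f y)) {a : ℕ}
    (ha : ∀ x, ¬ R (f x) a) : CompRed IdEq R := by
  have key : ∀ m n, R (f^[m] a) (f^[n] a) → m = n := by
    intro m
    induction m with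
    | zero =>
      rintro (_ | n) h
      · rfl
      · rw [Function.iterate_succ_apply'] at h
        exact absurd (hR.symm h) (ha _)
    | succ m ih =>
      rintro (_ | n) h
      · rw [Function.iterate_succ_apply'] at h
        exact absurd h (ha _)
      · rw [Function.iterate_succ_apply', Function.iterate_succ_apply', ← hfr] at h
        rw [ih n h]
  refine ⟨fun n => f^[n] a, computable_iterate hf a, fun m n => ⟨fun h => ?_, key m n⟩⟩
  cases h
  exact hR.refl _

theorem infinite_classes_of_idEq {R : ℕ → ℕ → Prop} (hR : Equivalence R)
    (h : CompRed IdEq R) : (classes R).Infinite := by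
  obtain ⟨g, -, hg⟩ := h
  refine Set.infinite_of_injective_forall_mem (f := fun n => {z | R z (g n)}) ?_
    fun n => ⟨g n, rfl⟩
  intro m n hmn
  have hm : g m ∈ {z | R z (g n)} := (Set.ext_iff.1 hmn (g m)).1 (hR.refl (g m))
  exact (hg m n).2 hm

theorem computable_find_lt {f : ℕ → ℕ} (hf : Computable f) (hex : ∀ m, ∃ k, f m < f k) :
    Computable fun m => Nat.find (hex m) := by
  have hlt : Computable₂ fun a b : ℕ => decide (a < b) := Primrec.nat_lt.decide.to_comp
  have hp : Computable₂ fun m k : ℕ => decide (f m < f k) :=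
    (hlt.comp (hf.comp Computable.fst) (hf.comp Computable.snd)).to₂
  refine (Partrec.rfind hp.partrec₂).of_eq fun m => ?_
  refine Part.eq_some_iff.2 (Nat.mem_rfind.2 ⟨?_, fun {k} hk => ?_⟩)
  · simpa using Nat.find_spec (hex m)
  · simpa using Nat.find_min (hex m) hk

theorem idEq_compRed_of_infinite {S : ℕ → ℕ → Prop} (hS : CompRed S IdEq)
    (hinf : (classes S).Infinite) : CompRed IdEq S := by
  obtain ⟨f, hf, hfr⟩ := hS
  have hrange : (Set.range f).Infinite := by
    intro hfin
    refine hinf ((hfin.image fun v => {z | f z = v}).subset ?_)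
    rintro _ ⟨a, rfl⟩
    exact ⟨f a, ⟨a, rfl⟩, Set.ext fun z => (hfr z a).symm⟩
  have hex : ∀ m, ∃ k, f m < f k := by
    intro m
    obtain ⟨_, ⟨k, rfl⟩, hk⟩ := hrange.exists_gt (f m)
    exact ⟨k, hk⟩
  have hmono : StrictMono fun n => f ((fun m => Nat.find (hex m))^[n] 0) := by
    refine strictMono_nat_of_lt_succ fun n => ?_
    rw [Function.iterate_succ_apply']
    exact Nat.find_spec (hex _)
  refine ⟨_, computable_iterate (computable_find_lt hf hex) 0, fun m n => ?_⟩
  rw [hfr]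
  exact hmono.injective.eq_iff.symm

theorem computablePred_class_of_compRed_idEq {R : ℕ → ℕ → Prop} (h : CompRed R IdEq) (a : ℕ) :
    ComputablePred fun z => R z a := by
  obtain ⟨f, hf, hfr⟩ := h
  have heq : Computable₂ fun a b : ℕ => decide (a = b) := Primrec.eq.decide.to_comp
  refine ComputablePred.of_eq (p := fun z => f z = f a) ⟨inferInstance, ?_⟩
    fun z => (hfr z a).symm
  exact heq.comp hf (Computable.const (f a))

/-- Collapsing a computable class of `R` to another one gives a relation below `R` that still has
infinitely many classes; a reduction of `R` to it gives a self-reduction of `R` that misses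
the collapsed class. -/
theorem idEq_compRed_of_computable_class {R : ℕ → ℕ → Prop} (hR : Equivalence R)
    (hinf : (classes R).Infinite)
    (hmin : ∀ S : ℕ → ℕ → Prop, Equivalence S → StrictRed S R → (classes S).Finite)
    {a : ℕ} (ha : ComputablePred fun z => R z a) : CompRed IdEq R := by
  obtain ⟨hdec, hcomp⟩ := ha
  obtain ⟨b, hb⟩ : ∃ b, ¬ R b a := by
    by_contra! hall
    refine hinf ((Set.finite_singleton {z | R z a}).subset ?_)
    rintro _ ⟨c, rfl⟩
    exact Set.ext fun z => ⟨fun _ => hall z, fun _ => hR.trans (hall z) (hR.symm (hall c))⟩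
  let f : ℕ → ℕ := fun x => bif decide (R x a) then b else x
  have hf : Computable f := Computable.cond hcomp (Computable.const b) Computable.id
  have hpos : ∀ {x}, R x a → f x = b := fun h => by simp [f, h]
  have hneg : ∀ {x}, ¬ R x a → f x = x := fun h => by simp [f, h]
  have havoid : ∀ x, ¬ R (f x) a := by
    intro x
    by_cases hx : R x a
    · rwa [hpos hx]
    · rwa [hneg hx]
  let S : ℕ → ℕ → Prop := fun x y => R (f x) (f y)
  have hSinf : (classes S).Infinite := by
    intro hfin
    refine hinf (((hfin.image fun D => D \ {z | R z a}).insert {z | R z a}).subset ?_)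
    rintro _ ⟨c, rfl⟩
    by_cases hc : R c a
    · exact Or.inl (Set.ext fun z => ⟨fun h => hR.trans h hc, fun h => hR.trans h (hR.symm hc)⟩)
    · refine Or.inr ⟨{z | S z c}, ⟨c, rfl⟩, Set.ext fun z => ⟨?_, fun h => ?_⟩⟩
      · rintro ⟨h, hz⟩
        have h' : R (f z) (f c) := h
        rwa [hneg hz, hneg hc] at h'
      · have hz : ¬ R z a := fun hz => hc (hR.trans (hR.symm h) hz)
        refine ⟨?_, hz⟩
        change R (f z) (f c)
        rwa [hneg hz, hneg hc]
  have hSeq : Equivalence S := ⟨fun _ => hR.refl _, hR.symm, hR.trans⟩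
  have hRS : CompRed R S := by
    by_contra hn
    exact hSinf (hmin S hSeq ⟨⟨f, hf, fun _ _ => Iff.rfl⟩, hn⟩)
  obtain ⟨g, hg, hgr⟩ := hRS
  exact compRed_idEq_of_avoids hR (hf.comp hg) hgr fun x => havoid (g x)

theorem stmt_15 (R : ℕ → ℕ → Prop) (hR : Equivalence R) :
    EquivC R IdEq ↔ NCA R ∧ (classes R).Infinite ∧
      ∀ S : ℕ → ℕ → Prop, Equivalence S → StrictRed S R → (classes S).Finite := by
  constructor
  · rintro ⟨hRI, hIR⟩
    refine ⟨fun F hF => ⟨id, Computable.id, fun _ _ => Iff.rfl, fun a haF =>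
      absurd (computablePred_class_of_compRed_idEq hRI a) (hF a haF)⟩,
      infinite_classes_of_idEq hR hIR, fun S _ hSR => ?_⟩
    by_contra hinf
    exact hSR.2 (hRI.trans (idEq_compRed_of_infinite (hSR.1.trans hRI) hinf))
  · rintro ⟨hnca, hinf, hmin⟩
    have hIR : CompRed IdEq R := by
      by_cases h0 : ComputablePred fun z => R z 0
      · exact idEq_compRed_of_computable_class hR hinf hmin h0
      · obtain ⟨g, hg, hgr, havoid⟩ := hnca {0} fun a ha => by
          rwa [Finset.mem_singleton.1 ha]
        exact compRed_idEq_of_avoids hR hg hgr (havoid 0 (Finset.mem_singleton_self 0))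
    refine ⟨?_, hIR⟩
    by_contra hn
    have hId : Equivalence IdEq := ⟨fun _ => rfl, Eq.symm, Eq.trans⟩
    exact infinite_classes_of_idEq hId ⟨id, Computable.id, fun _ _ => Iff.rfl⟩
      (hmin IdEq hId ⟨hIR, hn⟩)
end

section
/- Let R be an equivalence relation on ℕ with at least two equivalence classes. Then R has continuum many self-full strong minimal covers: there is a map T from (ℕ → Bool) to equivalence relations on ℕ such that for every g : ℕ → Bool, T g is self-full and a strong minimal cover of R, and for all g ≠ h, ¬(T g ≤c T h). -/
open Cardinal in
/-- If the fibres of `c` are countable, then `c` is injective on some perfect-sized family avoiding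
any prescribed value. -/
theorem exists_injective_comp_of_countable_fibers {β : Type} (c : (ℕ → Bool) → β)
    (hc : ∀ b, (c ⁻¹' {b}).Countable) (b₀ : β) :
    ∃ F : (ℕ → Bool) → ℕ → Bool, (c ∘ F).Injective ∧ ∀ g, c (F g) ≠ b₀ := by
  have hα : #(ℕ → Bool) = 𝔠 := by simp
  have hrange : #(ℕ → Bool) ≤ #(Set.range c) * ℵ₀ := by
    refine mk_le_mk_mul_of_mk_preimage_le (Set.rangeFactorization c) fun b => ?_
    refine le_trans (mk_le_mk_of_subset (t := c ⁻¹' {b.1}) ?_) (hc b.1).le_aleph0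
    rintro g rfl
    rfl
  have hcont : 𝔠 ≤ #(Set.range c) := by
    by_contra! hlt
    exact absurd (hα ▸ hrange) (not_le.2 (mul_lt_of_lt aleph0_le_continuum hlt aleph0_lt_continuum))
  have hdiff : 𝔠 ≤ #(Set.range c \ {b₀} : Set β) := by
    by_contra! hlt
    have hle := le_mk_sdiff_add_mk (Set.range c) {b₀}
    rw [mk_singleton] at hle
    exact absurd (hcont.trans hle) (not_le.2 (add_lt_of_lt aleph0_le_continuum hlt
      (one_lt_aleph0.trans aleph0_lt_continuum)))
  obtain ⟨e⟩ := le_def _ _ |>.1 (hα.trans_le hdiff)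
  choose F hF using fun g => (e g).2.1
  refine ⟨F, fun g h hgh => e.injective (Subtype.ext ?_), fun g => ?_⟩
  · simpa [hF] using hgh
  · rw [hF]
    exact (e g).2.2

theorem CompRed.refl (R : ℕ → ℕ → Prop) : CompRed R R :=
  ⟨id, Computable.id, fun _ _ => Iff.rfl⟩

/-- Only countably many relations reduce to a given one. -/
theorem countable_compRed (S : ℕ → ℕ → Prop) : {X | CompRed X S}.Countable := by
  refine (Set.countable_range fun (f : {f : ℕ → ℕ // Computable f}) x y =>
    S (f.1 x) (f.1 y)).mono ?_
  rintro X ⟨f, hf, hX⟩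
  exact ⟨⟨f, hf⟩, by funext x y; exact propext (hX x y).symm⟩

theorem computable_find_lt_s18 {u : ℕ → ℕ} (hu : Computable u) (hub : ∀ B, ∃ x, B < u x) :
    Computable fun B => Nat.find (hub B) :=
  Computable.find (P := fun B x => B < u x)
    (Computable.computablePred ((Primrec.nat_lt.decide.to_comp.comp Computable.fst
      (hu.comp Computable.snd)).of_eq fun _ => rfl)) hub

/-- An unbounded computable function takes distinct nonzero values on a computable sequence, from
which the index can be computed. -/
theorem exists_computable_index {u : ℕ → ℕ} (hu : Computable u) (hub : ∀ B, ∃ x, B < u x) :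
    ∃ x ind : ℕ → ℕ, Computable x ∧ Computable ind ∧ ∀ i, 0 < u (x i) ∧ ind (u (x i)) = i := by
  let F : ℕ → ℕ := fun B => Nat.find (hub B)
  have hF : Computable F := computable_find_lt_s18 hu hub
  have hFu : ∀ B, B < u (F B) := fun B => Nat.find_spec (hub B)
  let x : ℕ → ℕ := fun i => Nat.rec (F 0) (fun _ z => F (u z)) i
  have hx : Computable x := Computable.nat_rec (h := fun _ (p : ℕ × ℕ) => F (u p.2))
    Computable.id (Computable.const _)
    (hF.comp (hu.comp (Computable.snd.comp Computable.snd))).to₂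
  have hmono : StrictMono (u ∘ x) := strictMono_nat_of_lt_succ fun i => hFu _
  have hv : Computable fun i => u (x i) + 1 := Computable.succ.comp (hu.comp hx)
  have hvb : ∀ B, ∃ i, B < u (x i) + 1 := fun B => ⟨B, Nat.lt_succ_of_le (hmono.id_le B)⟩
  refine ⟨x, fun B => Nat.find (hvb B), hx, computable_find_lt_s18 hv hvb, fun i => ⟨?_, ?_⟩⟩
  · exact (Nat.zero_le _).trans_lt ((hFu 0).trans_le (hmono.monotone (Nat.zero_le i)))
  · refine (Nat.find_eq_iff _).2 ⟨Nat.lt_succ_self _, fun j hj => ?_⟩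
    have := hmono hj
    simp only [Function.comp_apply] at this
    omega

/-- A condition assigns to each number an even label `2 * c`, placing it in the class of `2 * c`, or
an odd label, leaving its class undecided but equal to that of all numbers with the same label. -/
structure IsCondition (P : ℕ → ℕ) : Prop where
  computable : Computable P
  two_mul : ∀ c, P (2 * c) = 2 * c
  unbounded : ∀ B, ∃ m, P m % 2 = 1 ∧ B < P m

/-- `P'` extends `P` by relabelling, keeping the even labels. -/
def Extends (P P' : ℕ → ℕ) : Prop :=
  ∃ Q : ℕ → ℕ, (∀ c, Q (2 * c) = 2 * c) ∧ ∀ m, P' m = Q (P m)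

theorem Extends.refl (P : ℕ → ℕ) : Extends P P := ⟨id, fun _ => rfl, fun _ => rfl⟩

theorem Extends.trans {P₀ P₁ P₂ : ℕ → ℕ} (h : Extends P₀ P₁) (h' : Extends P₁ P₂) :
    Extends P₀ P₂ := by
  obtain ⟨Q, hQ, hP⟩ := h
  obtain ⟨Q', hQ', hP'⟩ := h'
  exact ⟨Q' ∘ Q, fun c => by simp [hQ, hQ'], fun m => by simp [hP, hP']⟩

theorem Extends.even {P P' : ℕ → ℕ} (h : Extends P P') {m c : ℕ} (hm : P m = 2 * c) :
    P' m = 2 * c := by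
  obtain ⟨Q, hQ, hP⟩ := h
  rw [hP, hm, hQ]

theorem Extends.eq {P P' : ℕ → ℕ} (h : Extends P P') {m n : ℕ} (hm : P m = P n) :
    P' m = P' n := by
  obtain ⟨Q, -, hP⟩ := h
  rw [hP, hP, hm]

theorem isCondition_id : IsCondition id :=
  ⟨Computable.id, fun _ => rfl, fun B => ⟨2 * B + 1, by simp, by simp; omega⟩⟩

theorem computable_mod_two_decide {u : ℕ → ℕ} (hu : Computable u) :
    ComputablePred fun n => u n % 2 = 0 :=
  Computable.computablePred
    (Primrec.eq.decide.to_comp.comp (Primrec.nat_mod.to_comp.comp hu (Computable.const 2))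
      (Computable.const 0))

/-- The undecided labels up to a bound can all be decided at once. -/
theorem IsCondition.fix {P : ℕ → ℕ} (hP : IsCondition P) (B c : ℕ) :
    ∃ P', IsCondition P' ∧ Extends P P' ∧ ∀ m, P m % 2 = 1 → P m ≤ B → P' m = 2 * c := by
  let Q : ℕ → ℕ := fun v => if v % 2 = 0 then v else if v ≤ B then 2 * c else v
  have hQ : Computable Q :=
    (computable_mod_two_decide Computable.id).ite Computable.id
      (ComputablePred.ite (Computable.const _) Computable.id
        (Primrec.nat_le.comp Primrec.id (Primrec.const B)).computablePred)
  refine ⟨Q ∘ P, ⟨hQ.comp hP.computable, fun d => ?_, fun B' => ?_⟩,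
    ⟨Q, fun d => ?_, fun m => rfl⟩, fun m hm hmB => ?_⟩
  · simp [Q, hP.two_mul]
  · obtain ⟨m, hm, hmB⟩ := hP.unbounded (max B B')
    have hQm : Q (P m) = P m := by
      simp only [Q]
      rw [if_neg (by omega), if_neg (by omega)]
    exact ⟨m, by simpa [hQm] using hm, by simp only [Function.comp_apply, hQm]; omega⟩
  · simp [Q]
  · simp [Q, hm, hmB]

/-- `P` decides `f` if it decides the class of every value of `f`, or else the values of `f`
computably meet every label. -/
def Decides (P f : ℕ → ℕ) : Prop :=
  (∀ x, P (f x) % 2 = 0) ∨ ∃ y : ℕ → ℕ, Computable y ∧ ∀ m, P (f (y m)) = P m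

theorem IsCondition.exists_decides {P : ℕ → ℕ} (hP : IsCondition P) {f : ℕ → ℕ}
    (hf : Computable f) : ∃ P', IsCondition P' ∧ Extends P P' ∧ Decides P' f := by
  by_cases hb : ∃ B, ∀ x, P (f x) % 2 = 1 → P (f x) ≤ B
  · obtain ⟨B, hB⟩ := hb
    obtain ⟨P', hP', hext, hfix⟩ := hP.fix B 0
    refine ⟨P', hP', hext, Or.inl fun x => ?_⟩
    rcases Nat.mod_two_eq_zero_or_one (P (f x)) with h | h
    · rw [hext.even (c := P (f x) / 2) (by omega)]
      omega
    · rw [hfix _ h (hB x h)]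
  · push Not at hb
    let u : ℕ → ℕ := fun x => if P (f x) % 2 = 0 then 0 else P (f x)
    have hPf : Computable fun x => P (f x) := hP.computable.comp hf
    have hu : Computable u := (computable_mod_two_decide hPf).ite (Computable.const 0) hPf
    have hub : ∀ B, ∃ x, B < u x := fun B => by
      obtain ⟨x, hx, hxB⟩ := hb B
      exact ⟨x, by simpa [u, hx] using hxB⟩
    obtain ⟨x, ind, hx, hind, hxi⟩ := exists_computable_index hu hub
    let Q : ℕ → ℕ := fun v => if v % 2 = 0 then v else ind v
    have hQ : Computable Q := (computable_mod_two_decide Computable.id).ite Computable.id hind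
    have hQx : ∀ i, Q (P (f (x i))) = i := fun i => by
      obtain ⟨h₀, h₁⟩ := hxi i
      by_cases h : P (f (x i)) % 2 = 0
      · simp [u, h] at h₀
      · simpa [u, Q, h] using h₁
    refine ⟨Q ∘ P, ⟨hQ.comp hP.computable, fun d => ?_, fun B => ⟨f (x (2 * B + 1)), ?_, ?_⟩⟩,
      ⟨Q, fun d => ?_, fun m => rfl⟩,
      Or.inr ⟨fun m => x (Q (P m)), hx.comp (hQ.comp hP.computable), fun m => ?_⟩⟩
    · simp [Q, hP.two_mul]
    · simp only [Function.comp_apply, hQx]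
      omega
    · simp only [Function.comp_apply, hQx]
      omega
    · simp [Q]
    · simp [hQx]

/-- One step of the construction: decide `f` after branching at some number `m`. -/
theorem IsCondition.exists_step {P : ℕ → ℕ} (hP : IsCondition P) {f : ℕ → ℕ} (hf : Computable f) :
    ∃ m, ∀ c, ∃ P', IsCondition P' ∧ Extends P P' ∧ Decides P' f ∧ P' m = 2 * c := by
  obtain ⟨m, hm, -⟩ := hP.unbounded 0
  refine ⟨m, fun c => ?_⟩
  obtain ⟨P₁, hP₁, hext₁, hfix⟩ := hP.fix (P m) c
  obtain ⟨P₂, hP₂, hext₂, hdec⟩ := hP₁.exists_decides hf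
  exact ⟨P₂, hP₂, hext₁.trans hext₂, hdec, hext₂.even (hfix m hm le_rfl)⟩

/-- A chain of conditions is realized by an assignment of classes. -/
theorem exists_realization {P : ℕ → ℕ → ℕ} (hP : ∀ s, Extends (P s) (P (s + 1))) :
    ∃ H : ℕ → ℕ, (∀ s m c, P s m = 2 * c → H m = c) ∧
      ∀ s m n, P s m = P s n → H m = H n := by
  have hle : ∀ s t, s ≤ t → Extends (P s) (P t) := fun s t hst => by
    induction t, hst using Nat.le_induction with
    | base => exact Extends.refl _
    | succ t _ ih => exact ih.trans (hP t)
  have huniq : ∀ m s t c d, P s m = 2 * c → P t m = 2 * d → c = d := fun m s t c d hs ht => by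
    have h₁ := (hle s _ (le_max_left s t)).even hs
    have h₂ := (hle t _ (le_max_right s t)).even ht
    omega
  have hex : ∀ m, ∃ d, (∀ s c, P s m = 2 * c → d = c) ∧
      ((∀ s c, P s m ≠ 2 * c) → d = 0) := fun m => by
    by_cases h : ∃ s c, P s m = 2 * c
    · obtain ⟨s, c, hs⟩ := h
      exact ⟨c, fun t d ht => huniq m s t c d hs ht, fun h => absurd hs (h s c)⟩
    · push Not at h
      exact ⟨0, fun s c hs => absurd hs (h s c), fun _ => rfl⟩
  choose H hH hH₀ using hex
  refine ⟨H, fun s m c => hH m s c, fun s m n hmn => ?_⟩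
  have htransfer : ∀ {m n}, P s m = P s n → ∀ t c, P t m = 2 * c →
      P (max s t) n = 2 * c := fun hmn t c ht => by
    rw [← (hle s _ (le_max_left s t)).eq hmn]
    exact (hle t _ (le_max_right s t)).even ht
  by_cases h : ∃ t c, P t m = 2 * c
  · obtain ⟨t, c, ht⟩ := h
    rw [hH m t c ht, hH n _ c (htransfer hmn t c ht)]
  · push Not at h
    rw [hH₀ m h, hH₀ n fun t c ht => h _ c (htransfer hmn.symm t c ht)]

/-- An assignment of classes is generic if it is realized by conditions deciding all computable
functions. -/
def IsGeneric (H : ℕ → ℕ) : Prop :=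
  ∀ f, Computable f → ∃ P, IsCondition P ∧ Decides P f ∧
    (∀ m c, P m = 2 * c → H m = c) ∧ ∀ m n, P m = P n → H m = H n

theorem exists_generic_family (a b : ℕ) :
    ∃ H : (ℕ → Bool) → ℕ → ℕ, (∀ g, IsGeneric (H g)) ∧
      ∀ g h, g ≠ h → ∃ m, (H g m = a ∧ H h m = b) ∨ (H g m = b ∧ H h m = a) := by
  have : Nonempty {f : ℕ → ℕ // Computable f} := ⟨⟨id, Computable.id⟩⟩
  obtain ⟨e, he⟩ := exists_surjective_nat {f : ℕ → ℕ // Computable f}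
  choose m step hcond hext hdec hval using
    fun (P : {P // IsCondition P}) (f : {f : ℕ → ℕ // Computable f}) => P.2.exists_step f.2
  let Pg : (ℕ → Bool) → ℕ → {P // IsCondition P} := fun g s =>
    Nat.rec ⟨id, isCondition_id⟩
      (fun s P => ⟨step P (e s) (if g s then a else b), hcond _ _ _⟩) s
  have hchain : ∀ g s, Extends (Pg g s).1 (Pg g (s + 1)).1 := fun g s => hext _ _ _
  choose H hH hHeq using fun g => exists_realization (P := fun s => (Pg g s).1) (hchain g)
  have hHm : ∀ g s, H g (m (Pg g s) (e s)) = if g s then a else b := fun g s =>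
    hH g (s + 1) _ _ (hval _ _ _)
  refine ⟨H, fun g f hf => ?_, fun g h hgh => ?_⟩
  · obtain ⟨s, hs⟩ := he ⟨f, hf⟩
    refine ⟨(Pg g (s + 1)).1, (Pg g (s + 1)).2, ?_, hH g (s + 1), hHeq g (s + 1)⟩
    have : (e s).1 = f := by rw [hs]
    exact this ▸ hdec (Pg g s) (e s) (if g s then a else b)
  · have hne : ∃ s, g s ≠ h s := Function.ne_iff.1 hgh
    have hPeq : ∀ s ≤ Nat.find hne, Pg g s = Pg h s := fun s => by
      induction s with
      | zero => exact fun _ => rfl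
      | succ s ih =>
        intro hs
        have hgs : g s = h s := not_not.1 (Nat.find_min hne hs)
        have := ih (by omega)
        change (⟨step (Pg g s) (e s) (if g s then a else b), _⟩ : {P // IsCondition P}) =
          ⟨step (Pg h s) (e s) (if h s then a else b), _⟩
        simp only [this, hgs]
    have hs := Nat.find_spec hne
    generalize Nat.find hne = s at hs hPeq
    have h₁ := hHm g s
    have h₂ := hHm h s
    rw [← hPeq s le_rfl] at h₂
    refine ⟨m (Pg g s) (e s), ?_⟩
    cases hg : g s <;> cases hh : h s <;> simp_all

namespace IsGeneric

variable {R : ℕ → ℕ → Prop} {H : ℕ → ℕ}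

theorem two_mul (hH : IsGeneric H) (c : ℕ) : H (2 * c) = c := by
  obtain ⟨P, hP, -, hPH, -⟩ := hH id Computable.id
  exact hPH _ _ (hP.two_mul c)

theorem compRed (hH : IsGeneric H) : CompRed R fun m n => R (H m) (H n) :=
  ⟨fun c => 2 * c, (Primrec.nat_mul.comp (Primrec.const 2) Primrec.id).to_comp, fun x y => by
    simp only [hH.two_mul]⟩

/-- Either `H ∘ f` is computable or `H` factors computably through `H ∘ f`. -/
theorem dichotomy (hH : IsGeneric H) {f : ℕ → ℕ} (hf : Computable f) :
    Computable (H ∘ f) ∨ ∃ y : ℕ → ℕ, Computable y ∧ ∀ m, H (f (y m)) = H m := by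
  obtain ⟨P, hP, hdec | ⟨y, hy, hPy⟩, hPH, hPeq⟩ := hH f hf
  · refine Or.inl (((Primrec.nat_div.comp Primrec.id (Primrec.const 2)).to_comp.comp
      (hP.computable.comp hf)).of_eq fun x => ?_)
    refine (hPH _ _ ?_).symm
    have := hdec x
    simp only [id]
    omega
  · exact Or.inr ⟨y, hy, fun m => hPeq _ _ (hPy m)⟩

theorem compRed_or_compRed (hH : IsGeneric H) {X : ℕ → ℕ → Prop}
    (hX : CompRed X fun m n => R (H m) (H n)) :
    CompRed X R ∨ CompRed (fun m n => R (H m) (H n)) X := by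
  obtain ⟨f, hf, hXf⟩ := hX
  rcases hH.dichotomy hf with h | ⟨y, hy, hHy⟩
  · exact Or.inl ⟨H ∘ f, h, hXf⟩
  · exact Or.inr ⟨y, hy, fun m n => by simp only [hXf, hHy]⟩

theorem selfFull (hH : IsGeneric H) (hR : Equivalence R)
    (hHR : ¬ CompRed (fun m n => R (H m) (H n)) R) : SelfFull fun m n => R (H m) (H n) := by
  intro f hf hfr y
  rcases hH.dichotomy hf with h | ⟨z, -, hz⟩
  · exact absurd ⟨H ∘ f, h, hfr⟩ hHR
  · exact ⟨z y, by simpa only [hz] using hR.refl _⟩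

theorem strongMinCover (hH : IsGeneric H) (hHR : ¬ CompRed (fun m n => R (H m) (H n)) R) :
    StrongMinCover R fun m n => R (H m) (H n) :=
  ⟨⟨hH.compRed, hHR⟩, fun _ _ hX => (hH.compRed_or_compRed hX.1).resolve_right hX.2⟩

end IsGeneric

theorem stmt_18 (R : ℕ → ℕ → Prop) (hR : Equivalence R) (h2 : ∃ a b, ¬ R a b) :
    ∃ T : (ℕ → Bool) → ℕ → ℕ → Prop,
      (∀ g, Equivalence (T g) ∧ SelfFull (T g) ∧ StrongMinCover R (T g)) ∧
      ∀ g h, g ≠ h → ¬ CompRed (T g) (T h) := by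
  obtain ⟨a, b, hab⟩ := h2
  obtain ⟨H, hH, hsep⟩ := exists_generic_family a b
  let T : (ℕ → Bool) → ℕ → ℕ → Prop := fun g m n => R (H g m) (H g n)
  have hinj : T.Injective := fun g h hgh => by
    by_contra hne
    obtain ⟨m, ⟨hg, hh⟩ | ⟨hg, hh⟩⟩ := hsep g h hne
    · have := congrFun (congrFun hgh m) (2 * a)
      simp only [T, hg, hh, (hH _).two_mul, eq_iff_iff] at this
      exact hab (hR.symm (this.1 (hR.refl a)))
    · have := congrFun (congrFun hgh m) (2 * a)
      simp only [T, hg, hh, (hH _).two_mul, eq_iff_iff] at this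
      exact hab (hR.symm (this.2 (hR.refl a)))
  let deg : (ℕ → ℕ → Prop) → Set (ℕ → ℕ → Prop) := fun S => {X | EquivC X S}
  have hdeg : ∀ {S S'}, EquivC S S' ↔ deg S = deg S' := fun {S S'} => by
    refine ⟨fun h => Set.ext fun X => ?_, fun h => ?_⟩
    · exact ⟨fun hX => ⟨hX.1.trans h.1, h.2.trans hX.2⟩,
        fun hX => ⟨hX.1.trans h.2, h.1.trans hX.2⟩⟩
    · exact (h ▸ ⟨.refl S, .refl S⟩ : S ∈ deg S')
  have hcount : ∀ d, ((fun g => deg (T g)) ⁻¹' {d}).Countable := fun d => by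
    rcases Set.eq_empty_or_nonempty ((fun g => deg (T g)) ⁻¹' {d}) with h | ⟨h, rfl⟩
    · simp [h]
    · exact ((countable_compRed (T h)).preimage hinj).mono fun g hg => (hdeg.2 hg).1
  obtain ⟨F, hFinj, hFR⟩ :=
    exists_injective_comp_of_countable_fibers (fun g => deg (T g)) hcount (deg R)
  have hTR : ∀ g, ¬ CompRed (T (F g)) R := fun g h => hFR g (hdeg.1 ⟨h, (hH _).compRed⟩)
  refine ⟨T ∘ F, fun g => ⟨hR.comap _, (hH (F g)).selfFull hR (hTR g),
      (hH (F g)).strongMinCover (hTR g)⟩,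
    fun g h hne hgh => hne (hFinj (hdeg.1 ⟨hgh, ?_⟩))⟩
  exact ((hH _).compRed_or_compRed hgh).resolve_left (hTR g)
end
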